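/- Let n, m ≥ 1, let B ∈ ℝ^{n×m} have linearly independent columns, let E, Q ∈ ℝ^{n×n} be symmetric positive definite, let Fθ ∈ ℝⁿ, ρ ∈ [0,1], λ > 0. Define V_L(α0, α1) = −(1−ρ) α0ᵀ BᵀEB α0 − ρ (Bα1 + Fθ)ᵀ E (Bα1 + Fθ) − (λ/2) (Fθ + B(α1 − α0))ᵀ Q⁻¹ (Fθ + B(α1 − α0)) for α0, α1 ∈ ℝ^m. For a symmetric matrix M and symmetric positive semidefinite T with Bᵀ(M+T)B invertible, write B̃_T(M) = (Bᵀ(M+T)B)⁻¹ Bᵀ M. Then all the inverses below exist, and the pair α1* = −B̃_0( (1−ρ) E B B̃_{2(1−ρ)E/λ}(Q⁻¹) + ρ E ) F θ, α0* = B̃_{2(1−ρ)E/λ}(Q⁻¹) (Fθ + B α1*) maximizes V_L over ℝ^m × ℝ^m. -/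

import Mathlib

open Matrix

lemma Matrix.mulVec_dotProduct_eq {ι κ : Type*} [Fintype ι] [Fintype κ]
    (B : Matrix ι κ ℝ) (d : κ → ℝ) (z : ι → ℝ) :
    (B *ᵥ d) ⬝ᵥ z = d ⬝ᵥ (Bᵀ *ᵥ z) := by
  rw [dotProduct_mulVec, vecMul_transpose]

lemma Matrix.PosDef.transpose_mul_mul {ι κ : Type*} [Fintype ι] [Fintype κ]
    {A : Matrix ι ι ℝ} (hA : A.PosDef) {B : Matrix ι κ ℝ}
    (hB : LinearIndependent ℝ Bᵀ) : (Bᵀ * A * B).PosDef := by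
  have h := hA.conjTranspose_mul_mul_same (B := B) (mulVec_injective_iff.2 hB)
  rwa [conjTranspose_eq_transpose_of_trivial] at h

lemma Matrix.PosDef.dotProduct_mulVec_add {ι : Type*} [Fintype ι]
    {A : Matrix ι ι ℝ} (hA : A.PosDef) (x h : ι → ℝ) :
    (x + h) ⬝ᵥ (A *ᵥ (x + h)) =
      x ⬝ᵥ (A *ᵥ x) + 2 * (h ⬝ᵥ (A *ᵥ x)) + h ⬝ᵥ (A *ᵥ h) := by
  have hs : Aᵀ = A := by
    simpa [conjTranspose_eq_transpose_of_trivial] using hA.isHermitian.eq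
  have : x ⬝ᵥ (A *ᵥ h) = h ⬝ᵥ (A *ᵥ x) := by
    rw [dotProduct_comm, mulVec_dotProduct_eq, hs]
  rw [mulVec_add, add_dotProduct, dotProduct_add, dotProduct_add, this]
  ring

lemma Matrix.PosDef.dotProduct_mulVec_self_nonneg {ι : Type*} [Fintype ι]
    {A : Matrix ι ι ℝ} (hA : A.PosDef) (x : ι → ℝ) : 0 ≤ x ⬝ᵥ (A *ᵥ x) := by
  simpa using hA.posSemidef.dotProduct_mulVec_nonneg x

lemma Matrix.PosDef.isUnit_mul_add_smul {ι : Type*} [Fintype ι] [DecidableEq ι]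
    {P R : Matrix ι ι ℝ} (hP : P.PosDef) (hR : R.PosDef) {c ρ : ℝ} (hc : 0 ≤ c) (hρ : 0 ≤ ρ) :
    IsUnit ((1 - ρ) • (P * ((R + c • P)⁻¹ * R)) + ρ • P) := by
  have hN : IsUnit (R + c • P) := (hR.add_posSemidef (hP.posSemidef.smul hc)).isUnit
  have hS : IsUnit (R + (ρ * c) • P) :=
    (hR.add_posSemidef (hP.posSemidef.smul (mul_nonneg hρ hc))).isUnit
  rw [← mulVec_injective_iff_isUnit] at hS ⊢
  have hPi := mulVec_injective_iff_isUnit.2 hP.isUnit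
  have hRi := mulVec_injective_iff_isUnit.2 hR.isUnit
  rw [← coe_mulVecLin, injective_iff_map_eq_zero]
  intro v hv
  rw [mulVecLin_apply] at hv
  obtain ⟨w, hw⟩ : ∃ w, w = ((R + c • P)⁻¹ * R) *ᵥ v := ⟨_, rfl⟩
  have h1 : (R + c • P) *ᵥ w = R *ᵥ v := by
    rw [hw, mulVec_mulVec, ← Matrix.mul_assoc, mul_nonsing_inv _ ((isUnit_iff_isUnit_det _).1 hN),
      Matrix.one_mul]
  have h2 : (1 - ρ) • w + ρ • v = 0 := by
    apply hPi
    rw [mulVec_zero, ← hv, hw]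
    simp only [mulVec_add, add_mulVec, mulVec_smul, smul_mulVec, mulVec_mulVec]
  have h3 : (R + (ρ * c) • P) *ᵥ w = 0 := by
    have h4 : R *ᵥ ((1 - ρ) • w + ρ • v) = 0 := by rw [h2, mulVec_zero]
    rw [mulVec_add, mulVec_smul, mulVec_smul, ← h1] at h4
    rw [← h4]
    simp only [add_mulVec, smul_mulVec]
    module
  have hw0 : w = 0 := hS (by simpa using h3)
  apply hRi
  simp only [mulVec_zero]
  rw [← h1, hw0, mulVec_zero]

/-- Proposition 4: the limited-information utility-privacy objective
`V_L(α0,α1)` for the linear system is maximized at the stated pair `(α0*, α1*)`,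
expressed via `B̃_T(M) = (Bᵀ(M+T)B)⁻¹ Bᵀ M`; all required inverses exist. -/
theorem stmt13 {n m : ℕ} (hn : 1 ≤ n) (hm : 1 ≤ m)
    (B : Matrix (Fin n) (Fin m) ℝ) (hB : LinearIndependent ℝ Bᵀ)
    (E Q : Matrix (Fin n) (Fin n) ℝ) (hE : E.PosDef) (hQ : Q.PosDef)
    (f : Fin n → ℝ) (ρ : ℝ) (hρ : ρ ∈ Set.Icc (0 : ℝ) 1)
    (lam : ℝ) (hlam : 0 < lam)
    (VL : (Fin m → ℝ) → (Fin m → ℝ) → ℝ)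
    (hVL : ∀ α0 α1, VL α0 α1 =
      -(1 - ρ) * (α0 ⬝ᵥ ((Bᵀ * E * B) *ᵥ α0)) -
        ρ * ((B *ᵥ α1 + f) ⬝ᵥ (E *ᵥ (B *ᵥ α1 + f))) -
        lam / 2 * ((f + B *ᵥ (α1 - α0)) ⬝ᵥ (Q⁻¹ *ᵥ (f + B *ᵥ (α1 - α0)))))
    -- `Btil = B̃_{2(1−ρ)E/λ}(Q⁻¹)`
    (Btil : Matrix (Fin m) (Fin n) ℝ)
    (hBtil : Btil = (Bᵀ * (Q⁻¹ + (2 * (1 - ρ) / lam) • E) * B)⁻¹ * Bᵀ * Q⁻¹)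
    -- `M = (1−ρ) E B B̃_{2(1−ρ)E/λ}(Q⁻¹) + ρ E`
    (M : Matrix (Fin n) (Fin n) ℝ)
    (hM : M = (1 - ρ) • (E * B * Btil) + ρ • E)
    (α1s α0s : Fin m → ℝ)
    (hα1s : α1s = -(((Bᵀ * M * B)⁻¹ * Bᵀ * M) *ᵥ f))
    (hα0s : α0s = Btil *ᵥ (f + B *ᵥ α1s)) :
    IsUnit (Bᵀ * (Q⁻¹ + (2 * (1 - ρ) / lam) • E) * B) ∧
    IsUnit (Bᵀ * M * B) ∧
    ∀ α0 α1 : Fin m → ℝ, VL α0 α1 ≤ VL α0s α1s := by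
  obtain ⟨hρ0, hρ1⟩ := hρ
  have hP := hE.transpose_mul_mul hB
  have hR := hQ.inv.transpose_mul_mul hB
  have hc : 0 ≤ 2 * (1 - ρ) / lam := div_nonneg (by linarith) hlam.le
  have hN : Bᵀ * (Q⁻¹ + (2 * (1 - ρ) / lam) • E) * B =
      Bᵀ * Q⁻¹ * B + (2 * (1 - ρ) / lam) • (Bᵀ * E * B) := by
    simp [Matrix.mul_add, Matrix.add_mul]
  have hU : IsUnit (Bᵀ * (Q⁻¹ + (2 * (1 - ρ) / lam) • E) * B) := by
    rw [hN]
    exact (hR.add_posSemidef (hP.posSemidef.smul hc)).isUnit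
  have hUM : IsUnit (Bᵀ * M * B) := by
    convert hP.isUnit_mul_add_smul hR hc hρ0 using 1
    rw [hM, hBtil, hN]
    simp only [Matrix.mul_add, Matrix.add_mul, Matrix.mul_smul, Matrix.smul_mul, Matrix.mul_assoc]
  refine ⟨hU, hUM, fun α0 α1 => ?_⟩
  obtain ⟨g, hg⟩ : ∃ g, g = B *ᵥ α1s + f := ⟨_, rfl⟩
  have hα0g : α0s = Btil *ᵥ g := by rw [hα0s, hg, add_comm]
  have hMg : Bᵀ *ᵥ (M *ᵥ g) = 0 := by
    have h1 : (Bᵀ * M * B) *ᵥ α1s = -((Bᵀ * M) *ᵥ f) := by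
      rw [hα1s, mulVec_neg, mulVec_mulVec, Matrix.mul_assoc (Bᵀ * M * B)⁻¹, ← Matrix.mul_assoc,
        mul_nonsing_inv _ ((isUnit_iff_isUnit_det _).1 hUM), Matrix.one_mul]
    rw [hg, mulVec_mulVec, mulVec_add, mulVec_mulVec, h1, neg_add_cancel]
  have hα0 : Bᵀ *ᵥ (Q⁻¹ *ᵥ (B *ᵥ α0s)) +
      (2 * (1 - ρ) / lam) • (Bᵀ *ᵥ (E *ᵥ (B *ᵥ α0s))) = Bᵀ *ᵥ (Q⁻¹ *ᵥ g) := by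
    have h1 : (Bᵀ * (Q⁻¹ + (2 * (1 - ρ) / lam) • E) * B) *ᵥ α0s = (Bᵀ * Q⁻¹) *ᵥ g := by
      rw [hα0g, hBtil, mulVec_mulVec, Matrix.mul_assoc (Bᵀ * _ * B)⁻¹, ← Matrix.mul_assoc,
        mul_nonsing_inv _ ((isUnit_iff_isUnit_det _).1 hU), Matrix.one_mul]
    rw [hN, add_mulVec, smul_mulVec] at h1
    simpa only [mulVec_mulVec, Matrix.mul_assoc] using h1
  have hMg' : (1 - ρ) • (Bᵀ *ᵥ (E *ᵥ (B *ᵥ α0s))) + ρ • (Bᵀ *ᵥ (E *ᵥ g)) = 0 := by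
    rw [← hMg, hM, hα0g]
    simp only [mulVec_add, add_mulVec, mulVec_smul, smul_mulVec, mulVec_mulVec, Matrix.mul_assoc]
  have stat0 (d : Fin m → ℝ) : (1 - ρ) * ((B *ᵥ d) ⬝ᵥ (E *ᵥ (B *ᵥ α0s))) =
      lam / 2 * ((B *ᵥ d) ⬝ᵥ (Q⁻¹ *ᵥ (g - B *ᵥ α0s))) := by
    simp only [mulVec_dotProduct_eq, mulVec_sub, dotProduct_sub, ← hα0, dotProduct_add,
      dotProduct_smul, smul_eq_mul]
    field_simp
    ring
  have stat1 (d : Fin m → ℝ) : ρ * ((B *ᵥ d) ⬝ᵥ (E *ᵥ g)) +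
      lam / 2 * ((B *ᵥ d) ⬝ᵥ (Q⁻¹ *ᵥ (g - B *ᵥ α0s))) = 0 := by
    rw [← stat0]
    have h := congrArg (d ⬝ᵥ ·) hMg'
    simp only [dotProduct_add, dotProduct_smul, smul_eq_mul, dotProduct_zero] at h
    simp only [mulVec_dotProduct_eq]
    linarith
  have hquad (a : Fin m → ℝ) :
      a ⬝ᵥ ((Bᵀ * E * B) *ᵥ a) = (B *ᵥ a) ⬝ᵥ (E *ᵥ (B *ᵥ a)) := by
    simp only [mulVec_dotProduct_eq, mulVec_mulVec, Matrix.mul_assoc]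
  obtain ⟨d0, rfl⟩ : ∃ d, α0 = α0s + d := ⟨α0 - α0s, by abel⟩
  obtain ⟨d1, rfl⟩ : ∃ d, α1 = α1s + d := ⟨α1 - α1s, by abel⟩
  have e1 : B *ᵥ (α1s + d1) + f = g + B *ᵥ d1 := by rw [hg, mulVec_add]; abel
  have e2 : f + B *ᵥ (α1s + d1 - (α0s + d0)) = (g - B *ᵥ α0s) + (B *ᵥ d1 - B *ᵥ d0) := by
    rw [hg, mulVec_sub, mulVec_add, mulVec_add]; abel
  have e3 : f + B *ᵥ (α1s - α0s) = g - B *ᵥ α0s := by rw [hg, mulVec_sub]; abel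
  rw [hVL, hVL, hquad, hquad, e1, e2, e3, ← hg, mulVec_add B, hE.dotProduct_mulVec_add,
    hE.dotProduct_mulVec_add, hQ.inv.dotProduct_mulVec_add, sub_dotProduct (B *ᵥ d1) (B *ᵥ d0)
    (Q⁻¹ *ᵥ (g - B *ᵥ α0s))]
  have n0 := mul_nonneg (sub_nonneg.2 hρ1) (hE.dotProduct_mulVec_self_nonneg (B *ᵥ d0))
  have n1 := mul_nonneg hρ0 (hE.dotProduct_mulVec_self_nonneg (B *ᵥ d1))
  have n2 := mul_nonneg hlam.le (hQ.inv.dotProduct_mulVec_self_nonneg (B *ᵥ d1 - B *ᵥ d0))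
  have s0 := stat0 d0
  have s1 := stat1 d1
  linarith
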